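/- Fix a model M ∈ ℳ, a latent window z = (z₁, …, z_{2h}) ∈ 𝒵^{2h}, and δ_{X|Z} ∈ (0, 1). Suppose the observations x = (x₁, …, x_{2h}) are independent with each xᵢ drawn from f(x | zᵢ; θ₁*, M) for some θ₁* ∈ Θ₁(M), and define the level-1 change statistic Φ^{X|Z} = (1/(2h)) [ L_NML(x | z; M) − L_NML(x⁻ | z⁻; M) − L_NML(x⁺ | z⁺; M) ], where (x⁻, z⁻) and (x⁺, z⁺) are the first and second halves of the window. If the threshold satisfies ε_{X|Z} ≥ (log C_{X|Z}(M) − log δ_{X|Z}) / (2h), where C_{X|Z}(M) = max_{z ∈ 𝒵^{2h}} C_{X|z}(M), then P(Φ^{X|Z} > ε_{X|Z}) ≤ δ_{X|Z}. -/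

import Mathlib

noncomputable section

/-- First half (length `h`) of a window of length `2*h`. -/
def firstHalf {γ : Type*} (h : ℕ) (w : Fin (2 * h) → γ) : Fin h → γ :=
  fun i => w ⟨i.1, by have := i.2; omega⟩

/-- Second half (length `h`) of a window of length `2*h`. -/
def secondHalf {γ : Type*} (h : ℕ) (w : Fin (2 * h) → γ) : Fin h → γ :=
  fun i => w ⟨h + i.1, by have := i.2; omega⟩

/-- Conditional parametric complexity
`C_{X|zⁿ} = ∑_{xⁿ} f(xⁿ | zⁿ; θ̂₁)`, where `fhat₁ n x z` is the maximized
conditional likelihood. -/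
def CXcond {𝒳 𝒵 : Type*} [Fintype 𝒳] [Fintype 𝒵]
    (fhat₁ : (n : ℕ) → (Fin n → 𝒳) → (Fin n → 𝒵) → ℝ)
    (n : ℕ) (z : Fin n → 𝒵) : ℝ :=
  ∑ x : Fin n → 𝒳, fhat₁ n x z

/-- Conditional NML code length
`L_NML(xⁿ | zⁿ) = -log₂ f(xⁿ | zⁿ; θ̂₁) + log₂ C_{X|zⁿ}`. -/
def LNMLcond {𝒳 𝒵 : Type*} [Fintype 𝒳] [Fintype 𝒵]
    (fhat₁ : (n : ℕ) → (Fin n → 𝒳) → (Fin n → 𝒵) → ℝ)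
    (n : ℕ) (x : Fin n → 𝒳) (z : Fin n → 𝒵) : ℝ :=
  -Real.logb 2 (fhat₁ n x z) + Real.logb 2 (CXcond fhat₁ n z)

/-- Level-1 change statistic
`Φ^{X|Z} = (1/(2h)) [ L_NML(x|z) − L_NML(x⁻|z⁻) − L_NML(x⁺|z⁺) ]` on a window
of length `2h`. -/
def PhiXZ {𝒳 𝒵 : Type*} [Fintype 𝒳] [Fintype 𝒵]
    (fhat₁ : (n : ℕ) → (Fin n → 𝒳) → (Fin n → 𝒵) → ℝ)
    (h : ℕ) (x : Fin (2 * h) → 𝒳) (z : Fin (2 * h) → 𝒵) : ℝ :=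
  (1 / (2 * (h : ℝ))) *
    (LNMLcond fhat₁ (2 * h) x z
      - LNMLcond fhat₁ h (firstHalf h x) (firstHalf h z)
      - LNMLcond fhat₁ h (secondHalf h x) (secondHalf h z))

/-- Worst-case conditional complexity `C_{X|Z} = max_{z ∈ 𝒵^{2h}} C_{X|z}`. -/
def CXZ {𝒳 𝒵 : Type*} [Fintype 𝒳] [Fintype 𝒵] [Nonempty 𝒵]
    (fhat₁ : (n : ℕ) → (Fin n → 𝒳) → (Fin n → 𝒵) → ℝ) (n : ℕ) : ℝ :=
  ⨆ z : Fin n → 𝒵, CXcond fhat₁ n z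

theorem firstHalf_secondHalf_injective {γ : Type*} (h : ℕ) :
    Function.Injective fun w : Fin (2 * h) → γ => (firstHalf h w, secondHalf h w) := by
  intro v w hvw
  obtain ⟨h₁, h₂⟩ := Prod.ext_iff.mp hvw
  funext ⟨i, hi⟩
  by_cases hih : i < h
  · exact congrFun h₁ ⟨i, hih⟩
  · have key := congrFun h₂ ⟨i - h, by omega⟩
    simpa [secondHalf, Nat.add_sub_cancel' (not_lt.mp hih)] using key

/-- Summing a product of nonnegative functions of the two halves over all windows is bounded by
the product of the sums. -/
theorem sum_mul_halves_le {γ : Type*} [Fintype γ] (h : ℕ) {a b : (Fin h → γ) → ℝ}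
    (ha : ∀ x, 0 ≤ a x) (hb : ∀ x, 0 ≤ b x) :
    ∑ x : Fin (2 * h) → γ, a (firstHalf h x) * b (secondHalf h x) ≤ (∑ x, a x) * ∑ x, b x := by
  classical
  rw [Finset.sum_mul_sum, ← Finset.sum_product',
    ← Finset.sum_image (s := Finset.univ) (f := fun p : (Fin h → γ) × (Fin h → γ) => a p.1 * b p.2)
      (firstHalf_secondHalf_injective h).injOn]
  exact Finset.sum_le_sum_of_subset_of_nonneg (fun p _ => by simp)
    fun p _ _ => mul_nonneg (ha _) (hb _)

/-- An alarm at a window with positive likelihoods forces the maximized likelihood of the whole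
window below `δ` times the product of the normalized maximum likelihoods of its halves. -/
theorem le_of_lt_PhiXZ {𝒳 𝒵 : Type*} [Fintype 𝒳] [Fintype 𝒵] [Nonempty 𝒵]
    (fhat₁ : (n : ℕ) → (Fin n → 𝒳) → (Fin n → 𝒵) → ℝ) {h : ℕ} (hpos : 0 < h)
    (h0 : ∀ n x z, 0 ≤ fhat₁ n x z)
    {x : Fin (2 * h) → 𝒳} {z : Fin (2 * h) → 𝒵} {δ ε : ℝ} (hδ : 0 < δ)
    (hε : (Real.logb 2 (CXZ fhat₁ (2 * h)) - Real.logb 2 δ) / (2 * h) ≤ ε)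
    (hx : 0 < fhat₁ (2 * h) x z) (hx₁ : 0 < fhat₁ h (firstHalf h x) (firstHalf h z))
    (hx₂ : 0 < fhat₁ h (secondHalf h x) (secondHalf h z)) (hΦ : ε < PhiXZ fhat₁ h x z) :
    fhat₁ (2 * h) x z ≤
      δ * (fhat₁ h (firstHalf h x) (firstHalf h z) / CXcond fhat₁ h (firstHalf h z) *
        (fhat₁ h (secondHalf h x) (secondHalf h z) / CXcond fhat₁ h (secondHalf h z))) := by
  have hC : ∀ {n x z}, 0 < fhat₁ n x z → 0 < CXcond fhat₁ n z := fun {n x z} hp =>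
    hp.trans_le (Finset.single_le_sum (f := fun y => fhat₁ n y z) (fun y _ => h0 n y z)
      (Finset.mem_univ x))
  have hmax : Real.logb 2 (CXcond fhat₁ (2 * h) z) ≤ Real.logb 2 (CXZ fhat₁ (2 * h)) :=
    Real.logb_le_logb_of_le one_lt_two (hC hx) (le_ciSup (Set.finite_range _).bddAbove z)
  have hh : (0 : ℝ) < 2 * h := by positivity
  have hlt := hε.trans_lt hΦ
  rw [PhiXZ, one_div_mul_eq_div, div_lt_div_iff_of_pos_right hh] at hlt
  have hq₁ := div_pos hx₁ (hC hx₁)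
  have hq₂ := div_pos hx₂ (hC hx₂)
  rw [← Real.logb_le_logb one_lt_two hx (mul_pos hδ (mul_pos hq₁ hq₂)),
    Real.logb_mul hδ.ne' (mul_pos hq₁ hq₂).ne', Real.logb_mul hq₁.ne' hq₂.ne',
    Real.logb_div hx₁.ne' (hC hx₁).ne', Real.logb_div hx₂.ne' (hC hx₂).ne']
  simp only [LNMLcond] at hlt
  linarith

/-- **Reliable alarms at level 1.**  Fix a latent window `z ∈ 𝒵^{2h}`.  If the
observations `x₁, …, x_{2h}` are independent with `xᵢ ~ f(x | zᵢ; θ₁*, M)` and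
the threshold satisfies `ε_{X|Z} ≥ (log₂ C_{X|Z}(M) − log₂ δ_{X|Z}) / (2h)`,
then `P(Φ^{X|Z} > ε_{X|Z}) ≤ δ_{X|Z}`. -/
theorem level1_type_one_error
    {𝒳 𝒵 : Type*} [Fintype 𝒳] [Fintype 𝒵] [Nonempty 𝒳] [Nonempty 𝒵]
    (h : ℕ) (hpos : 0 < h)
    (Θ₁ : Type*) [Nonempty Θ₁]
    (f₁ : Θ₁ → 𝒵 → 𝒳 → ℝ)
    (hf₁0 : ∀ θ z x, 0 ≤ f₁ θ z x) (hf₁1 : ∀ θ z, ∑ x, f₁ θ z x = 1)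
    (fhat₁ : (n : ℕ) → (Fin n → 𝒳) → (Fin n → 𝒵) → ℝ)
    (hfhat₁ : ∀ n (x : Fin n → 𝒳) (z : Fin n → 𝒵),
      IsGreatest (Set.range fun θ : Θ₁ => ∏ i, f₁ θ (z i) (x i)) (fhat₁ n x z))
    (θstar : Θ₁)
    (z : Fin (2 * h) → 𝒵)
    (δXZ : ℝ) (hδXZ : δXZ ∈ Set.Ioo (0 : ℝ) 1)
    (εXZ : ℝ)
    (hεXZ : εXZ ≥ (Real.logb 2 (CXZ fhat₁ (2 * h)) - Real.logb 2 δXZ) / (2 * h)) :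
    ∑ x : Fin (2 * h) → 𝒳,
      Set.indicator {x : Fin (2 * h) → 𝒳 | PhiXZ fhat₁ h x z > εXZ}
        (fun x => ∏ i, f₁ θstar (z i) (x i)) x
      ≤ δXZ := by
  have hle : ∀ n x z, ∏ i, f₁ θstar (z i) (x i) ≤ fhat₁ n x z := fun n x z =>
    (hfhat₁ n x z).2 ⟨θstar, rfl⟩
  have h0 : ∀ n x z, 0 ≤ fhat₁ n x z := fun n x z =>
    (Finset.prod_nonneg fun i _ => hf₁0 θstar (z i) (x i)).trans (hle n x z)
  set C₁ := CXcond fhat₁ h (firstHalf h z) with hC₁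
  set C₂ := CXcond fhat₁ h (secondHalf h z) with hC₂
  have hC₁0 : 0 ≤ C₁ := Finset.sum_nonneg fun x _ => h0 h x _
  have hC₂0 : 0 ≤ C₂ := Finset.sum_nonneg fun x _ => h0 h x _
  have hq₁ : ∀ x, 0 ≤ fhat₁ h x (firstHalf h z) / C₁ := fun x => div_nonneg (h0 _ _ _) hC₁0
  have hq₂ : ∀ x, 0 ≤ fhat₁ h x (secondHalf h z) / C₂ := fun x => div_nonneg (h0 _ _ _) hC₂0
  calc
    _ ≤ ∑ x : Fin (2 * h) → 𝒳, δXZ * (fhat₁ h (firstHalf h x) (firstHalf h z) / C₁ *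
          (fhat₁ h (secondHalf h x) (secondHalf h z) / C₂)) := by
      refine Finset.sum_le_sum fun x _ => ?_
      have hrhs := mul_nonneg hδXZ.1.le (mul_nonneg (hq₁ (firstHalf h x)) (hq₂ (secondHalf h x)))
      refine Set.indicator_apply_le' (fun hΦ => ?_) fun _ => hrhs
      by_cases hp : ∏ i, f₁ θstar (z i) (x i) = 0
      · exact hp.le.trans hrhs
      have hpos_factor : ∀ i, 0 < f₁ θstar (z i) (x i) := fun i =>
        (hf₁0 _ _ _).lt_of_ne' (Finset.prod_ne_zero_iff.mp hp i (Finset.mem_univ i))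
      exact (hle _ x z).trans (le_of_lt_PhiXZ fhat₁ hpos h0 hδXZ.1 hεXZ
        ((Finset.prod_pos fun i _ => hpos_factor i).trans_le (hle _ _ _))
        ((Finset.prod_pos fun i _ => hpos_factor _).trans_le (hle _ _ _))
        ((Finset.prod_pos fun i _ => hpos_factor _).trans_le (hle _ _ _)) hΦ)
    _ ≤ δXZ * (C₁ / C₁ * (C₂ / C₂)) := by
      rw [← Finset.mul_sum]
      refine mul_le_mul_of_nonneg_left ((sum_mul_halves_le h hq₁ hq₂).trans_eq ?_) hδXZ.1.le
      rw [← Finset.sum_div, ← Finset.sum_div]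
      rfl
    _ ≤ δXZ := mul_le_of_le_one_right hδXZ.1.le
      (mul_le_one₀ (div_self_le_one _) (div_nonneg hC₂0 hC₂0) (div_self_le_one _))

end
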